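/- Set D = z¹ − √2 z² e^{z³}. On the domain where z¹ > 0 and D > 0: (i) for all β,γ ∈ {1,2,3}, z¹ c_{1βγ} + √2 e^{z³} c_{2βγ} − c_{3βγ} = D η_{βγ}; consequently the vector field e with components (e¹,e²,e³) = (z¹/D, √2 e^{z³}/D, −1/D) satisfies Σ_α e^α c^γ_{αβ} = δ^γ_β for all β,γ, i.e. e is the unit of the multiplication with structure constants c^γ_{αβ}; (ii) e is the η-gradient of θ_{0,0} := z³ − log(z¹ − √2 z² e^{z³}), i.e. e^α = Σ_β η^{αβ} ∂θ_{0,0}/∂z^β for all α. -/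

import Mathlib

/-- Partial derivative in the first slot. -/
noncomputable def pd1 (f : ℝ → ℝ → ℝ → ℝ) : ℝ → ℝ → ℝ → ℝ :=
  fun x y z => deriv (fun t => f t y z) x

/-- Partial derivative in the second slot. -/
noncomputable def pd2 (f : ℝ → ℝ → ℝ → ℝ) : ℝ → ℝ → ℝ → ℝ :=
  fun x y z => deriv (fun t => f x t z) y

/-- Partial derivative in the third slot. -/
noncomputable def pd3 (f : ℝ → ℝ → ℝ → ℝ) : ℝ → ℝ → ℝ → ℝ :=
  fun x y z => deriv (fun t => f x y t) z

/-- Partial derivative in the (i+1)-st variable. -/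
noncomputable def pd (i : Fin 3) : (ℝ → ℝ → ℝ → ℝ) → (ℝ → ℝ → ℝ → ℝ) :=
  ![pd1, pd2, pd3] i

/-- The potential of the generalized Frobenius manifold of the (2,1)-type RR2T. -/
noncomputable def Fpot (x y z : ℝ) : ℝ :=
  (1/2) * x^2 * z + (1/2) * x * y^2 + Real.sqrt 2 * x * y * Real.exp z
    + (1/2) * x * Real.exp (2*z) - (1/24) * y^4 + (1/2) * x^2 * Real.log x

/-- The flat metric η, with η_{αβ} = 1 iff α + β = 4 (indices shifted to 0,1,2). -/
noncomputable def eta (a b : Fin 3) : ℝ := if (a : ℕ) + (b : ℕ) = 2 then 1 else 0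

/-- Third partial derivatives c_{αβγ} = ∂³F/∂z^α∂z^β∂z^γ of the potential. -/
noncomputable def cF (a b g : Fin 3) : ℝ → ℝ → ℝ → ℝ := pd a (pd b (pd g Fpot))

/-- Structure constants with one index raised: c^γ_{αβ} = Σ_δ η^{γδ} c_{δαβ}. -/
noncomputable def cup (g a b : Fin 3) (x y z : ℝ) : ℝ :=
  ∑ d : Fin 3, eta g d * cF d a b x y z

/-- θ_{0,0} = z³ − log(z¹ − √2 z² e^{z³}). -/
noncomputable def θ00 (x y z : ℝ) : ℝ :=
  z - Real.log (x - Real.sqrt 2 * y * Real.exp z)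

/-- First partial derivatives of the potential on `0 < x`. -/
noncomputable def gradF (i : Fin 3) (x y z : ℝ) : ℝ :=
  ![x * z + y ^ 2 / 2 + √2 * y * Real.exp z + Real.exp (2 * z) / 2 + x * Real.log x + x / 2,
    x * y + √2 * x * Real.exp z - y ^ 3 / 6,
    x ^ 2 / 2 + √2 * x * y * Real.exp z + x * Real.exp (2 * z)] i

/-- Second partial derivatives of the potential on `0 < x`. -/
noncomputable def hessF (i j : Fin 3) (x y z : ℝ) : ℝ :=
  !![z + Real.log x + 3 / 2, y + √2 * Real.exp z, x + √2 * y * Real.exp z + Real.exp (2 * z);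
    y + √2 * Real.exp z, x - y ^ 2 / 2, √2 * x * Real.exp z;
    x + √2 * y * Real.exp z + Real.exp (2 * z), √2 * x * Real.exp z,
      √2 * x * y * Real.exp z + 2 * x * Real.exp (2 * z)] i j

/-- Third partial derivatives of the potential on `0 < x`. -/
noncomputable def thirdF (i j k : Fin 3) (x y z : ℝ) : ℝ :=
  ![!![1 / x, 0, 1;
      0, 1, √2 * Real.exp z;
      1, √2 * Real.exp z, √2 * y * Real.exp z + 2 * Real.exp (2 * z)],
    !![0, 1, √2 * Real.exp z;
      1, -y, 0;
      √2 * Real.exp z, 0, √2 * x * Real.exp z],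
    !![1, √2 * Real.exp z, √2 * y * Real.exp z + 2 * Real.exp (2 * z);
      √2 * Real.exp z, 0, √2 * x * Real.exp z;
      √2 * y * Real.exp z + 2 * Real.exp (2 * z), √2 * x * Real.exp z,
        √2 * x * y * Real.exp z + 4 * x * Real.exp (2 * z)]] i j k

/-- Partial derivatives on `0 < x` depend only on the values of the function there. -/
lemma pd_congr {f g : ℝ → ℝ → ℝ → ℝ} (h : ∀ x y z, 0 < x → f x y z = g x y z)
    (i : Fin 3) {x : ℝ} (y z : ℝ) (hx : 0 < x) : pd i f x y z = pd i g x y z := by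
  fin_cases i
  · refine Filter.EventuallyEq.deriv_eq ?_
    filter_upwards [lt_mem_nhds hx] with t ht using h t y z ht
  · exact congrArg (deriv · y) (funext fun t => h x t z hx)
  · exact congrArg (deriv · z) (funext fun t => h x y t hx)

lemma pd_Fpot (i : Fin 3) (x y z : ℝ) (hx : 0 < x) : pd i Fpot x y z = gradF i x y z := by
  have hx' := hx.ne'
  fin_cases i <;> simp [pd, pd1, pd2, pd3, Fpot, gradF]
  all_goals
    simp (disch := fun_prop (disch := assumption)) [deriv_fun_add, deriv_fun_sub, deriv_fun_mul,
      deriv_fun_pow]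
    field_simp
    try ring

lemma pd_gradF (i j : Fin 3) (x y z : ℝ) (hx : 0 < x) :
    pd i (gradF j) x y z = hessF i j x y z := by
  have hx' := hx.ne'
  fin_cases i <;> fin_cases j <;> simp [pd, pd1, pd2, pd3, gradF, hessF]
  all_goals
    simp (disch := fun_prop (disch := assumption)) [deriv_fun_add, deriv_fun_sub, deriv_fun_mul,
      deriv_fun_pow, deriv_div_const]
    try field_simp
    try ring

lemma pd_hessF (i j k : Fin 3) (x y z : ℝ) (hx : 0 < x) :
    pd i (hessF j k) x y z = thirdF i j k x y z := by
  have hx' := hx.ne'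
  fin_cases i <;> fin_cases j <;> fin_cases k <;>
    simp [pd, pd1, pd2, pd3, hessF, thirdF]
  all_goals
    try simp (disch := fun_prop) [deriv_fun_add, deriv_fun_mul]
    try ring

lemma cF_eq (i j k : Fin 3) {x : ℝ} (y z : ℝ) (hx : 0 < x) :
    cF i j k x y z = thirdF i j k x y z := by
  rw [cF, pd_congr (g := hessF j k) _ i y z hx, pd_hessF i j k x y z hx]
  intro x y z hx
  rw [pd_congr (pd_Fpot k) j y z hx, pd_gradF j k x y z hx]

lemma thirdF_rotate (i j k : Fin 3) (x y z : ℝ) : thirdF i j k x y z = thirdF j k i x y z := by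
  fin_cases i <;> fin_cases j <;> fin_cases k <;> rfl

lemma thirdF_unity (j k : Fin 3) {x : ℝ} (y z : ℝ) (hx : 0 < x) :
    x * thirdF 0 j k x y z + √2 * Real.exp z * thirdF 1 j k x y z - thirdF 2 j k x y z
      = (x - √2 * y * Real.exp z) * eta j k := by
  have h2 : √(2 : ℝ) ^ 2 = 2 := Real.sq_sqrt zero_le_two
  have hexp : Real.exp (2 * z) = Real.exp z ^ 2 := by rw [two_mul, Real.exp_add, sq]
  fin_cases j <;> fin_cases k <;> simp [thirdF, eta, hexp] <;> grind

lemma sum_eta_mul_eta (i j : Fin 3) : ∑ k, eta i k * eta j k = if j = i then 1 else 0 := by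
  fin_cases i <;> fin_cases j <;> simp [eta, Fin.sum_univ_three]

/-- the identity z¹ c_{1βγ} + √2 e^{z³} c_{2βγ} − c_{3βγ} = D η_{βγ},
the fact that e = (z¹/D, √2 e^{z³}/D, −1/D) is the unit of the multiplication, and
e = grad_η θ_{0,0}. -/
theorem unity_of_M (x y z : ℝ) (hx : 0 < x)
    (hD : 0 < x - Real.sqrt 2 * y * Real.exp z) :
    (∀ β γ : Fin 3,
      x * cF 0 β γ x y z + Real.sqrt 2 * Real.exp z * cF 1 β γ x y z - cF 2 β γ x y z
        = (x - Real.sqrt 2 * y * Real.exp z) * eta β γ)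
    ∧ (∀ β γ : Fin 3,
        ∑ α : Fin 3,
          (![x, Real.sqrt 2 * Real.exp z, -1] α / (x - Real.sqrt 2 * y * Real.exp z)) *
            cup γ α β x y z
          = if β = γ then (1 : ℝ) else 0)
    ∧ (∀ α : Fin 3,
        ![x, Real.sqrt 2 * Real.exp z, -1] α / (x - Real.sqrt 2 * y * Real.exp z)
          = ∑ β : Fin 3, eta α β * pd β θ00 x y z) := by
  refine ⟨fun β γ => ?_, fun β γ => ?_, fun α => ?_⟩
  · simpa only [cF_eq _ _ _ y z hx] using thirdF_unity β γ y z hx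
  · set D := x - √2 * y * Real.exp z with hD_def
    calc
      _ = ∑ δ, eta γ δ * ((x * thirdF 0 β δ x y z + √2 * Real.exp z * thirdF 1 β δ x y z
            - thirdF 2 β δ x y z) / D) := by
        simp only [cup, cF_eq _ _ _ y z hx, thirdF_rotate _ _ β, Fin.sum_univ_three]
        simp
        ring
      _ = ∑ δ, eta γ δ * eta β δ := by
        simp only [thirdF_unity β _ y z hx, ← hD_def, mul_div_cancel_left₀ _ hD.ne']
      _ = _ := sum_eta_mul_eta γ β
  · have hD' := hD.ne'
    fin_cases α <;> simp [eta, Fin.sum_univ_three, pd, pd1, pd2, pd3, θ00]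
    all_goals
      simp (disch := first | assumption | fun_prop (disch := assumption)) [deriv_fun_sub, deriv.log,
        deriv_fun_mul]
      try field_simp
      try ring
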